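/- Let Q be a symmetric n×n integer matrix and A an m×n integer matrix, with all entries of Q and A of absolute value at most α. Let C be a p×n integer matrix and d ∈ ℤ^p, b ∈ ℤ^m, and let Δ be a positive integer such that the determinant of every square submatrix of C has absolute value at most Δ. Let y_1, …, y_r ∈ ℤⁿ be integer vectors forming a basis of the rational nullspace of C with ‖y_i‖∞ ≤ Δ² for every i. Suppose the system has an optimal solution, and let x₀ ∈ ℝⁿ be any vector with C x₀ = d. Then there exists an optimal solution x* such that at least one of the following holds: (1) there is a row a_j^T of A that is not a linear combination of the rows of C and an integer b_j' with b_j − α·n·Δ² ≤ b_j' ≤ b_j and a_j^T x* = b_j'; (2) there is an index i such that y_i^T Q is not a linear combination of the rows of C and |2 y_i^T Q x*| ≤ n²·Δ⁴·α; (3) ‖x* − x₀‖₁ ≤ Δ²·n. -/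

import Mathlib

open Matrix

/-- A feasible solution of the system `Ax ≤ b`, `Cx = d` over the integers. -/
def IsFeasible {n m p : ℕ} (A : Matrix (Fin m) (Fin n) ℤ) (b : Fin m → ℤ)
    (C : Matrix (Fin p) (Fin n) ℤ) (d : Fin p → ℤ) (x : Fin n → ℤ) : Prop :=
  A.mulVec x ≤ b ∧ C.mulVec x = d

/-- An optimal solution of the IQP: feasible and minimizing `xᵀQx` among feasible points. -/
def IsOptimal {n m p : ℕ} (Q : Matrix (Fin n) (Fin n) ℤ) (A : Matrix (Fin m) (Fin n) ℤ)
    (b : Fin m → ℤ) (C : Matrix (Fin p) (Fin n) ℤ) (d : Fin p → ℤ) (x : Fin n → ℤ) : Prop :=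
  IsFeasible A b C d x ∧
    ∀ z : Fin n → ℤ, IsFeasible A b C d z → x ⬝ᵥ Q.mulVec x ≤ z ⬝ᵥ Q.mulVec z


lemma aux_dep {n p : ℕ} (M : Matrix (Fin p) (Fin n) ℝ) (F : Set (Fin n))
    (h : ¬ LinearIndepOn ℝ M.col F) :
    ∃ w : Fin n → ℝ, (∃ i, w i ≠ 0) ∧ (∀ i, i ∉ F → w i = 0) ∧ M *ᵥ w = 0 := by
  classical
  rw [LinearIndepOn, Fintype.not_linearIndependent_iff] at h
  obtain ⟨g, hg, i, hi⟩ := h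
  refine ⟨fun j => if h : j ∈ F then g ⟨j, h⟩ else 0, ⟨i, by simpa using hi⟩, ?_, ?_⟩
  · intro i hi; simp [hi]
  · rw [Matrix.mulVec_eq_sum, ← hg]
    rw [← Finset.sum_subset (Finset.subset_univ (Finset.univ.filter (· ∈ F)))]
    · rw [Finset.sum_subtype (p := (· ∈ F)) (F := inferInstance) _ (by simp)]
      apply Finset.sum_congr rfl
      intro x _
      ext l
      simp [Matrix.col, mul_comm]
    · intro x _ hx
      have : x ∉ F := by simpa using hx
      ext l
      simp [this]

lemma aux_step {n p : ℕ} (M : Matrix (Fin p) (Fin n) ℝ) (v w : Fin n → ℝ)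
    (hw : ∃ i, w i ≠ 0) (hF : ∀ i, (∃ z : ℤ, v i = z) → w i = 0) (hM : M *ᵥ w = 0) :
    ∃ u : Fin n → ℝ, M *ᵥ u = M *ᵥ v ∧ (∀ i, (⌊v i⌋ : ℝ) ≤ u i ∧ u i ≤ ⌈v i⌉) ∧
      (∀ i, (∃ z : ℤ, v i = z) → ∃ z : ℤ, u i = z) ∧
      ∃ i, (¬ ∃ z : ℤ, v i = z) ∧ ∃ z : ℤ, u i = z := by
  classical
  let τ : Fin n → ℝ := fun i =>
    if 0 < w i then ((⌈v i⌉ : ℝ) - v i) / w i else ((⌊v i⌋ : ℝ) - v i) / w i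
  obtain ⟨i1, hi1⟩ := hw
  obtain ⟨i0, hi0, hmin⟩ := Finset.exists_min_image (Finset.univ.filter (fun i => w i ≠ 0)) τ
    ⟨i1, by simp [hi1]⟩
  have hi0 : w i0 ≠ 0 := by simpa using hi0
  have hmin : ∀ i, w i ≠ 0 → τ i0 ≤ τ i := fun i hi => hmin i (by simp [hi])
  have hτ : ∀ i, 0 ≤ τ i := by
    intro i
    have h1 := Int.le_ceil (v i)
    have h2 := Int.floor_le (v i)
    simp only [τ]
    split_ifs with h
    · exact div_nonneg (by linarith) h.le
    · exact div_nonneg_of_nonpos (by linarith) (by linarith)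
  refine ⟨v + τ i0 • w, ?_, ?_, ?_, i0, ?_, ?_⟩
  · rw [Matrix.mulVec_add, Matrix.mulVec_smul, hM]; simp
  · intro i
    have h1 := Int.le_ceil (v i)
    have h2 := Int.floor_le (v i)
    simp only [Pi.add_apply, Pi.smul_apply, smul_eq_mul]
    rcases lt_trichotomy (w i) 0 with h | h | h
    · have := hmin i h.ne
      have e : τ i = ((⌊v i⌋ : ℝ) - v i) / w i := by simp [τ, not_lt.2 h.le]
      rw [e, le_div_iff_of_neg h] at this
      have := mul_nonpos_of_nonneg_of_nonpos (hτ i0) h.le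
      constructor <;> linarith
    · simp [h, h1, h2]
    · have := hmin i h.ne'
      have e : τ i = ((⌈v i⌉ : ℝ) - v i) / w i := by simp [τ, h]
      rw [e, le_div_iff₀ h] at this
      have := mul_nonneg (hτ i0) h.le
      constructor <;> linarith
  · rintro i ⟨z, hz⟩
    exact ⟨z, by simp [hF i ⟨z, hz⟩, hz]⟩
  · exact fun h => hi0 (hF _ h)
  · simp only [Pi.add_apply, Pi.smul_apply, smul_eq_mul, τ]
    split_ifs
    · exact ⟨⌈v i0⌉, by field_simp; ring⟩
    · exact ⟨⌊v i0⌋, by field_simp; ring⟩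

lemma aux_vertex {n p : ℕ} (M : Matrix (Fin p) (Fin n) ℝ) (v : Fin n → ℝ) :
    ∃ u : Fin n → ℝ, M *ᵥ u = M *ᵥ v ∧ (∀ i, |u i - v i| ≤ 1) ∧
      LinearIndepOn ℝ M.col {i | ¬ ∃ z : ℤ, u i = z} := by
  classical
  suffices H : ∀ (N : ℕ) (v : Fin n → ℝ),
      (Finset.univ.filter (fun i => ¬ ∃ z : ℤ, v i = z)).card = N →
      ∃ u : Fin n → ℝ, M *ᵥ u = M *ᵥ v ∧ (∀ i, (⌊v i⌋ : ℝ) ≤ u i ∧ u i ≤ ⌈v i⌉) ∧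
      LinearIndepOn ℝ M.col {i | ¬ ∃ z : ℤ, u i = z} by
    obtain ⟨u, h1, h2, h3⟩ := H _ v rfl
    refine ⟨u, h1, fun i => ?_, h3⟩
    have := h2 i
    have a := Int.ceil_lt_add_one (v i)
    have b := Int.sub_one_lt_floor (v i)
    rw [abs_le]; constructor <;> linarith
  intro N
  induction N using Nat.strong_induction_on with
  | _ N ih =>
    intro v hv
    by_cases hli : LinearIndepOn ℝ M.col {i | ¬ ∃ z : ℤ, v i = z}
    · exact ⟨v, rfl, fun i => ⟨Int.floor_le _, Int.le_ceil _⟩, hli⟩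
    · obtain ⟨w, hw, hF, hM⟩ := aux_dep M _ hli
      obtain ⟨u, h1, h2, h3, i0, h4, h5⟩ := aux_step M v w hw
        (fun i hi => hF i (by simpa using hi)) hM
      obtain ⟨u', a1, a2, a3⟩ := ih _ (by
        rw [← hv]
        apply Finset.card_lt_card
        rw [Finset.ssubset_iff_of_subset]
        · exact ⟨i0, by simpa using h4, by simpa using h5⟩
        · intro i hi
          simp only [Finset.mem_filter, Finset.mem_univ, true_and] at hi ⊢
          exact fun h => hi (h3 i h)) u rfl
      refine ⟨u', a1.trans h1, fun i => ⟨le_trans ?_ (a2 i).1, le_trans (a2 i).2 ?_⟩, a3⟩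
      · exact_mod_cast Int.le_floor.2 (h2 i).1
      · exact_mod_cast Int.ceil_le.2 (h2 i).2

lemma aux_basis {n p : ℕ} (M : Matrix (Fin p) (Fin n) ℝ) (F : Set (Fin n))
    (hF : LinearIndepOn ℝ M.col F) :
    ∃ (k : ℕ) (ρ : Fin k → Fin p) (γ : Fin k → Fin n), Function.Injective γ ∧
      F ⊆ Set.range γ ∧ (M.submatrix ρ γ).det ≠ 0 ∧
      ∀ v, (∀ l, (M *ᵥ v) (ρ l) = 0) → M *ᵥ v = 0 := by
  classical
  obtain ⟨B, -, hFB, hspan, hB⟩ := exists_linearIndepOn_extension hF (Set.subset_univ F)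
  let k := Fintype.card B
  let eB : Fin k ≃ B := (Fintype.equivFin B).symm
  let γ : Fin k → Fin n := fun i => eB i
  let MB : Matrix (Fin p) (Fin k) ℝ := M.submatrix id γ
  have hMB : LinearIndependent ℝ MB.col := hB.comp eB eB.injective
  obtain ⟨R, -, -, hRspan, hR⟩ := exists_linearIndepOn_extension
    (linearIndepOn_empty ℝ MB.row) (Set.subset_univ ∅)
  have hcard : Fintype.card R = k := by
    have h1 : MB.rank = k := by 
      have := LinearIndependent.rank_matrix (M := MBᵀ) hMB
      rwa [Matrix.rank_transpose, Fintype.card_fin] at this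
    rw [Matrix.rank_eq_finrank_span_row] at h1
    have h2 := finrank_span_eq_card hR
    have h3 : Submodule.span ℝ (Set.range fun x : R => MB.row x) =
        Submodule.span ℝ (Set.range MB.row) := by
      rw [← Set.image_eq_range]
      apply le_antisymm
      · exact Submodule.span_mono (Set.image_subset_range _ _)
      · rw [Submodule.span_le, ← Set.image_univ]
        exact hRspan
    exact h2.symm.trans ((congrArg (fun W : Submodule ℝ (Fin k → ℝ) =>
      Module.finrank ℝ W) h3).trans h1)
  let eR : Fin k ≃ R := (Fintype.equivFinOfCardEq hcard).symm
  have key : ∀ w : Fin k → ℝ, (∀ l : R, (MB *ᵥ w) l = 0) → MB *ᵥ w = 0 := by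
    intro w hw
    ext l
    have hl := hRspan ⟨l, trivial, rfl⟩
    have : ∀ x ∈ Submodule.span ℝ (MB.row '' R), x ⬝ᵥ w = 0 := by
      intro x hx
      induction hx using Submodule.span_induction with
      | mem x hx => obtain ⟨l, hl, rfl⟩ := hx; exact hw ⟨l, hl⟩
      | zero => simp
      | add x y _ _ hx hy => rw [add_dotProduct, hx, hy, add_zero]
      | smul a x _ hx => rw [smul_dotProduct, hx, smul_zero]
    exact this _ hl
  refine ⟨k, fun i => eR i, γ, fun i j h => eB.injective (Subtype.ext h), ?_, ?_, ?_⟩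
  · intro i hi
    exact ⟨eB.symm ⟨i, hFB hi⟩, by simp [γ]⟩
  · intro hdet
    obtain ⟨w, hw0, hw⟩ := Matrix.exists_mulVec_eq_zero_iff.2 hdet
    have : MB *ᵥ w = 0 := by
      apply key
      intro l
      have := congrFun hw (eR.symm l)
      simpa [Matrix.mulVec, dotProduct, MB] using this
    exact hw0 (Matrix.mulVec_injective_iff.2 hMB (by simpa using this))
  · intro v hv
    have : ∃ w, MB *ᵥ w = M *ᵥ v := by
      have h1 : M *ᵥ v ∈ Submodule.span ℝ (M.col '' B) := by
        rw [Matrix.mulVec_eq_sum]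
        refine Submodule.sum_mem _ fun i _ => ?_
        have := Submodule.smul_mem _ (v i) (hspan ⟨i, trivial, rfl⟩)
        convert this using 1
        ext l; simp [Matrix.col, mul_comm]
      have h2 : M.col '' B = Set.range MB.col := by
        ext x; constructor
        · rintro ⟨i, hi, rfl⟩
          exact ⟨eB.symm ⟨i, hi⟩, by ext l; simp [MB, γ, Matrix.col]⟩
        · rintro ⟨i, rfl⟩
          exact ⟨γ i, (eB i).2, rfl⟩
      rw [h2, ← Matrix.range_mulVecLin] at h1
      exact h1
    obtain ⟨w, hw⟩ := this
    rw [← hw]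
    apply key
    intro l
    rw [hw]
    simpa using hv (eR.symm l)

lemma aux_card {k : ℕ} (S : Matrix (Fin k) (Fin k) ℤ) (hS : S.det ≠ 0) :
    Nat.card ((Fin k → ℤ) ⧸ LinearMap.range S.mulVecLin) = S.det.natAbs := by
  have hinj : Function.Injective S.mulVecLin := by
    rw [← LinearMap.ker_eq_bot, LinearMap.ker_eq_bot']
    intro w hw
    by_contra h
    exact hS (Matrix.exists_mulVec_eq_zero_iff.1 ⟨w, h, hw⟩)
  let e := LinearEquiv.ofInjective S.mulVecLin hinj
  rw [← Submodule.natAbs_det_basis_change (Pi.basisFun ℤ (Fin k)) _ ((Pi.basisFun ℤ (Fin k)).map e)]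
  congr 1
  rw [Module.Basis.det_apply]
  congr 1
  ext i j
  simp [e, Module.Basis.toMatrix_apply]

lemma aux_zero_sum {k : ℕ} (S : Matrix (Fin k) (Fin k) ℤ) (hS : S.det ≠ 0)
    (δ : ℕ) (hδ : δ = S.det.natAbs) (s : Fin δ → (Fin k → ℤ)) :
    ∃ T : Finset (Fin δ), T.Nonempty ∧ ∃ w, ∑ i ∈ T, s i = S *ᵥ w := by
  classical
  have hc := aux_card S hS
  have hfin : Finite ((Fin k → ℤ) ⧸ LinearMap.range S.mulVecLin) :=
    Nat.finite_of_card_ne_zero (by rw [hc]; simpa using hS)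
  have := Fintype.ofFinite ((Fin k → ℤ) ⧸ LinearMap.range S.mulVecLin)
  rw [Nat.card_eq_fintype_card] at hc
  let P : Fin (δ + 1) → Finset (Fin δ) := fun i => Finset.univ.filter (fun j => j.val < i.val)
  obtain ⟨a, b, hab, he⟩ := Fintype.exists_ne_map_eq_of_card_lt
    (fun i : Fin (δ + 1) =>
      (LinearMap.range S.mulVecLin).mkQ (∑ j ∈ P i, s j))
    (by rw [hc]; simp [hδ])
  wlog hlt : a < b generalizing a b
  · exact this b a hab.symm he.symm (lt_of_le_of_ne (not_lt.1 hlt) hab.symm)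
  have hsub : P a ⊆ P b := by
    intro j hj
    simp only [P, Finset.mem_filter, Finset.mem_univ, true_and] at hj ⊢
    exact hj.trans hlt
  refine ⟨P b \ P a, ⟨⟨a, by have := b.2; have : a.val < b.val := hlt; omega⟩, ?_⟩, ?_⟩
  · simp only [P, Finset.mem_sdiff, Finset.mem_filter, Finset.mem_univ, true_and]
    exact ⟨hlt, lt_irrefl _⟩
  · have h2 := (Submodule.Quotient.eq _).1 he.symm
    obtain ⟨w, hw⟩ := h2
    refine ⟨w, ?_⟩
    rw [Finset.sum_sdiff_eq_sub hsub, ← hw]; rfl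

lemma aux_conformal {n k : ℕ} (S : Matrix (Fin k) (Fin k) ℤ) (hS : S.det ≠ 0)
    (D : Fin n → (Fin k → ℤ)) (c : Fin n → ℤ) (hc : S.det.natAbs ≤ ∑ j, (c j).natAbs) :
    ∃ t : Fin n → ℕ, (∀ j, t j ≤ (c j).natAbs) ∧ 0 < ∑ j, t j ∧ ∑ j, t j ≤ S.det.natAbs ∧
      ∃ w, ∑ j, ((c j).sign * t j) • D j = S *ᵥ w := by
  classical
  have : Nonempty (Fin S.det.natAbs ↪ Σ j, Fin (c j).natAbs) := by
    apply Function.Embedding.nonempty_of_card_le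
    simpa using hc
  obtain ⟨f⟩ := this
  obtain ⟨T, hT, w, hw⟩ := aux_zero_sum S hS _ rfl (fun i => (c (f i).1).sign • D (f i).1)
  have hsum : ∑ j, (T.filter (fun i => (f i).1 = j)).card = T.card :=
    (Finset.card_eq_sum_card_fiberwise (fun _ _ => Finset.mem_univ _)).symm
  refine ⟨fun j => (T.filter (fun i => (f i).1 = j)).card, ?_, ?_, ?_, w, ?_⟩
  · intro j
    have h1 : (T.filter (fun i => (f i).1 = j)).card ≤
        (Finset.univ.filter (fun x : Σ j, Fin (c j).natAbs => x.1 = j)).card := by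
      apply Finset.card_le_card_of_injOn f
      · intro i hi; simpa using (Finset.mem_filter.1 hi).2
      · exact f.injective.injOn
    refine h1.trans ?_
    have h2 : (Finset.univ.filter (fun x : Σ j, Fin (c j).natAbs => x.1 = j)) ⊆
        (Finset.univ : Finset (Fin (c j).natAbs)).image (fun x => ⟨j, x⟩) := by
      rintro ⟨a, x⟩ hx
      obtain rfl : a = j := by simpa using hx
      simp
    refine (Finset.card_le_card h2).trans (Finset.card_image_le.trans (by simp))
  · simp only [hsum]; exact hT.card_pos
  · simp only [hsum]; simpa using Finset.card_le_univ T
  · rw [← hw, ← Finset.sum_fiberwise T (fun i => (f i).1)]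
    apply Finset.sum_congr rfl
    intro j _
    rw [Finset.sum_congr rfl (g := fun _ => (c j).sign • D j)]
    · ext l; simp; ring
    · intro i hi
      rw [(Finset.mem_filter.1 hi).2]

lemma aux_cramer {n p k Δ : ℕ} (C : Matrix (Fin p) (Fin n) ℤ)
    (hdet : ∀ (k : ℕ) (ρ : Fin k → Fin p) (γ : Fin k → Fin n),
      |(C.submatrix ρ γ).det| ≤ (Δ : ℤ))
    (ρ : Fin k → Fin p) (γ : Fin k → Fin n) (hγ : Function.Injective γ) (v : Fin n → ℝ)
    (hv : ∀ l, (C.map ((↑) : ℤ → ℝ) *ᵥ v) (ρ l) = 0) (a : Fin k) :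
    |((C.submatrix ρ γ).det : ℝ)| * |v (γ a)| ≤
      Δ * ∑ j, if j ∈ Set.range γ then 0 else |v j| := by
  classical
  set S : Matrix (Fin k) (Fin k) ℝ := (C.submatrix ρ γ).map ((↑) : ℤ → ℝ) with hS
  have hSdet : ((C.submatrix ρ γ).det : ℝ) = S.det := by
    have := RingHom.map_det (Int.castRingHom ℝ) (C.submatrix ρ γ)
    simpa using this
  let c : Fin n → ℝ := fun j => if j ∈ Set.range γ then 0 else v j
  let col : Fin n → Fin k → ℝ := fun j l => C (ρ l) j
  have h1 : S *ᵥ (fun b => v (γ b)) = - ∑ j, c j • col j := by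
    ext l
    have h := hv l
    simp only [Matrix.mulVec, dotProduct, Matrix.map_apply] at h
    rw [← Finset.sum_filter_add_sum_filter_not _ (fun j => j ∈ Set.range γ)] at h
    have e1 : ∑ j with j ∈ Set.range γ, (C (ρ l) j : ℝ) * v j =
        ∑ b, (C (ρ l) (γ b) : ℝ) * v (γ b) := by
      rw [← Finset.sum_image (s := Finset.univ) (g := γ) (f := fun j => (C (ρ l) j : ℝ) * v j)
        hγ.injOn]
      apply Finset.sum_congr _ (fun _ _ => rfl)
      ext j; simp
    have e2 : ∑ j with ¬ j ∈ Set.range γ, (C (ρ l) j : ℝ) * v j = ∑ j, c j * C (ρ l) j := by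
      rw [Finset.sum_filter]
      apply Finset.sum_congr rfl
      intro j _
      by_cases hj : j ∈ Set.range γ
      · simp only [c, hj, not_true, if_false, if_true, zero_mul]
      · simp only [c, hj, not_false_iff, if_false, if_true, mul_comm]
    rw [e1, e2] at h
    simp only [Matrix.mulVec, dotProduct, hS, Matrix.map_apply, Matrix.submatrix_apply,
      Pi.neg_apply, Finset.sum_apply, Pi.smul_apply, smul_eq_mul, col]
    linarith
  have h2 : S.det * v (γ a) = - ∑ j, c j * S.cramer (col j) a := by
    have : S.cramer (S *ᵥ (fun b => v (γ b))) a = S.det * v (γ a) := by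
      rw [Matrix.cramer_eq_adjugate_mulVec, Matrix.mulVec_mulVec, Matrix.adjugate_mul]
      simp [Matrix.smul_mulVec]
    rw [← this, h1]
    simp
  have h3 : ∀ j, |S.cramer (col j) a| ≤ Δ := by
    intro j
    have := hdet k ρ (Function.update γ a j)
    have e : S.cramer (col j) a = ((C.submatrix ρ (Function.update γ a j)).det : ℝ) := by
      rw [Matrix.cramer_apply]
      have := RingHom.map_det (Int.castRingHom ℝ) (C.submatrix ρ (Function.update γ a j))
      simp only [eq_intCast] at this
      rw [this]
      congr 1
      ext l b
      by_cases hb : b = a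
      · subst hb; simp [col]
      · simp [hb, hS]
    rw [e]
    exact_mod_cast this
  rw [hSdet, ← abs_mul, h2, abs_neg, Finset.mul_sum]
  refine (Finset.abs_sum_le_sum_abs _ _).trans (Finset.sum_le_sum fun j _ => ?_)
  rw [abs_mul]
  have : (if j ∈ Set.range γ then (0:ℝ) else |v j|) = |c j| := by
    simp only [c]; split_ifs <;> simp
  rw [this, mul_comm]
  exact mul_le_mul_of_nonneg_right (h3 j) (abs_nonneg _)

lemma aux_span {n p : ℕ} (C : Matrix (Fin p) (Fin n) ℤ) (a z : Fin n → ℤ)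
    (ha : ∃ lam : Fin p → ℚ, ∀ i, (a i : ℚ) = ∑ l, lam l * (C l i : ℚ))
    (hz : C *ᵥ z = 0) : a ⬝ᵥ z = 0 := by
  obtain ⟨lam, h⟩ := ha
  have : ((a ⬝ᵥ z : ℤ) : ℚ) = 0 := by
    simp only [dotProduct, Int.cast_sum, Int.cast_mul, h, Finset.sum_mul]
    rw [Finset.sum_comm]
    apply Finset.sum_eq_zero
    intro l _
    have hl := congrFun hz l
    simp only [Matrix.mulVec, dotProduct, Pi.zero_apply] at hl
    have hl' : ∑ i, (C l i : ℚ) * z i = 0 := by exact_mod_cast hl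
    simp only [mul_assoc, ← Finset.mul_sum, hl', mul_zero]
  exact_mod_cast this

lemma aux_dot {n : ℕ} (a z : Fin n → ℤ) (s t : ℤ) (hs : 0 ≤ s) (ha : ∀ i, |a i| ≤ s)
    (hz : ∀ i, |z i| ≤ t) : |a ⬝ᵥ z| ≤ n * (s * t) := by
  refine (Finset.abs_sum_le_sum_abs _ _).trans ?_
  refine (Finset.sum_le_card_nsmul _ _ (s * t) fun i _ => ?_).trans (by simp)
  rw [abs_mul]
  exact mul_le_mul (ha i) (hz i) (abs_nonneg _) hs

lemma aux_expand {n : ℕ} (Q : Matrix (Fin n) (Fin n) ℤ) (hQ : Q.IsSymm) (x z : Fin n → ℤ) :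
    (x - z) ⬝ᵥ Q *ᵥ (x - z) = x ⬝ᵥ Q *ᵥ x - 2 * (z ⬝ᵥ Q *ᵥ x) + z ⬝ᵥ Q *ᵥ z := by
  have h : x ⬝ᵥ Q *ᵥ z = z ⬝ᵥ Q *ᵥ x := by
    rw [Matrix.dotProduct_mulVec, ← Matrix.mulVec_transpose, hQ.eq, dotProduct_comm]
  rw [Matrix.mulVec_sub, sub_dotProduct, dotProduct_sub, dotProduct_sub, h]
  ring

lemma aux_closure (n m p r α Δ : ℕ)
    (Q : Matrix (Fin n) (Fin n) ℤ) (hQ : Q.IsSymm) (hQα : ∀ i j, |Q i j| ≤ (α : ℤ))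
    (A : Matrix (Fin m) (Fin n) ℤ) (hAα : ∀ i j, |A i j| ≤ (α : ℤ))
    (b : Fin m → ℤ)
    (C : Matrix (Fin p) (Fin n) ℤ) (d : Fin p → ℤ)
    (y : Fin r → Fin n → ℤ)
    (hy0 : ∀ i, C.mulVec (y i) = 0)
    (hspan : ∀ v : Fin n → ℚ, (C.map ((↑) : ℤ → ℚ)).mulVec v = 0 →
      v ∈ Submodule.span ℚ (Set.range fun i => fun j => ((y i j : ℤ) : ℚ)))
    (hynorm : ∀ i j, |y i j| ≤ (Δ : ℤ) ^ 2)
    (xs : Fin n → ℤ) (hxs : IsOptimal Q A b C d xs)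
    (h1 : ¬ ∃ j : Fin m,
          (¬ ∃ lam : Fin p → ℚ, ∀ i, (A j i : ℚ) = ∑ l, lam l * (C l i : ℚ)) ∧
          b j - (α : ℤ) * n * (Δ : ℤ) ^ 2 ≤ A.mulVec xs j ∧ A.mulVec xs j ≤ b j)
    (h2 : ¬ ∃ i : Fin r,
          (¬ ∃ lam : Fin p → ℚ,
            ∀ jj, ((Matrix.vecMul (y i) Q) jj : ℚ) = ∑ l, lam l * (C l jj : ℚ)) ∧
          |2 * (Matrix.vecMul (y i) Q ⬝ᵥ xs)| ≤ (n : ℤ) ^ 2 * (Δ : ℤ) ^ 4 * (α : ℤ))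
    (z : Fin n → ℤ) (hz : C *ᵥ z = 0) (hzb : ∀ i, |z i| ≤ (Δ : ℤ) ^ 2) :
    IsOptimal Q A b C d (xs - z) := by
  have feas : ∀ z : Fin n → ℤ, C *ᵥ z = 0 → (∀ i, |z i| ≤ (Δ : ℤ) ^ 2) →
      IsFeasible A b C d (xs - z) := by
    intro z hz hzb
    refine ⟨fun j => ?_, by rw [Matrix.mulVec_sub, hz, sub_zero]; exact hxs.1.2⟩
    rw [Matrix.mulVec_sub, Pi.sub_apply]
    have hb := hxs.1.1 j
    by_cases hj : ∃ lam : Fin p → ℚ, ∀ i, (A j i : ℚ) = ∑ l, lam l * (C l i : ℚ)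
    · have : (A *ᵥ z) j = 0 := aux_span C (A j) z hj hz
      rw [this, sub_zero]; exact hb
    · have hlt : (A *ᵥ xs) j < b j - (α : ℤ) * n * (Δ : ℤ) ^ 2 := by
        by_contra h
        exact h1 ⟨j, hj, not_lt.1 h, hb⟩
      have : |(A *ᵥ z) j| ≤ n * ((α : ℤ) * (Δ : ℤ) ^ 2) :=
        aux_dot (A j) z _ _ (by positivity) (hAα j) hzb
      have := (abs_le.1 this).1
      linarith
  have hneg : ∀ i, C *ᵥ (-y i) = 0 := fun i => by rw [Matrix.mulVec_neg, hy0, neg_zero]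
  have hyx : ∀ i, -(y i ⬝ᵥ Q *ᵥ y i) ≤ 2 * (y i ⬝ᵥ Q *ᵥ xs) ∧
      2 * (y i ⬝ᵥ Q *ᵥ xs) ≤ y i ⬝ᵥ Q *ᵥ y i := by
    intro i
    have a1 := hxs.2 _ (feas (y i) (hy0 i) (hynorm i))
    have a2 := hxs.2 _ (feas (-y i) (hneg i) (by simpa using hynorm i))
    rw [aux_expand Q hQ] at a1 a2
    simp only [Matrix.mulVec_neg, neg_dotProduct, dotProduct_neg, neg_neg] at a2
    constructor <;> linarith
  have hin : ∀ i, ∃ lam : Fin p → ℚ,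
      ∀ jj, ((Matrix.vecMul (y i) Q) jj : ℚ) = ∑ l, lam l * (C l jj : ℚ) := by
    intro i
    by_contra h
    apply h2
    refine ⟨i, h, ?_⟩
    rw [← Matrix.dotProduct_mulVec]
    have b1 : ∀ j, |(Q *ᵥ y i) j| ≤ n * ((α : ℤ) * (Δ : ℤ) ^ 2) := fun j =>
      aux_dot (Q j) (y i) _ _ (by positivity) (hQα j) (hynorm i)
    have b2 := aux_dot (y i) (Q *ᵥ y i) _ _ (by positivity) (hynorm i) b1
    have b3 : |2 * (y i ⬝ᵥ Q *ᵥ xs)| ≤ y i ⬝ᵥ Q *ᵥ y i := abs_le.2 (hyx i)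
    refine b3.trans ((le_abs_self _).trans (b2.trans (le_of_eq ?_)))
    ring
  have hgen : ∀ g : Fin n → ℤ, (∀ i, y i ⬝ᵥ g = 0) → z ⬝ᵥ g = 0 := by
    intro g hg
    have hzq : (fun j => (z j : ℚ)) ∈
        Submodule.span ℚ (Set.range fun i => fun j => ((y i j : ℤ) : ℚ)) := by
      apply hspan
      ext l
      have := congrFun hz l
      simp only [Matrix.mulVec, dotProduct, Pi.zero_apply, Matrix.map_apply] at this ⊢
      exact_mod_cast this
    have : ∀ v ∈ Submodule.span ℚ (Set.range fun i => fun j => ((y i j : ℤ) : ℚ)),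
        v ⬝ᵥ (fun j => (g j : ℚ)) = 0 := by
      intro v hv
      induction hv using Submodule.span_induction with
      | mem x hx =>
        obtain ⟨i, rfl⟩ := hx
        have := hg i
        simp only [dotProduct] at this ⊢
        exact_mod_cast this
      | zero => simp
      | add x y _ _ hx hy => rw [add_dotProduct, hx, hy, add_zero]
      | smul a x _ hx => rw [smul_dotProduct, hx, smul_zero]
    have := this _ hzq
    simp only [dotProduct] at this ⊢
    exact_mod_cast this
  have e1 : z ⬝ᵥ Q *ᵥ z = 0 := hgen _ fun i => by
    rw [Matrix.dotProduct_mulVec]; exact aux_span C _ z (hin i) hz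
  have e2 : z ⬝ᵥ Q *ᵥ xs = 0 := hgen _ fun i => by
    have : y i ⬝ᵥ Q *ᵥ y i = 0 := by
      rw [Matrix.dotProduct_mulVec]; exact aux_span C _ _ (hin i) (hy0 i)
    have := hyx i
    omega
  refine ⟨feas z hz hzb, fun w hw => ?_⟩
  rw [aux_expand Q hQ, e1, e2]
  simpa using hxs.2 w hw

/-- main structural lemma. If the IQP has an optimal solution and `Cx₀ = d`,
then some optimal solution `x*` satisfies one of: (1) a row `a_j` of `A` independent of the
rows of `C` has `b_j - αnΔ² ≤ a_jᵀx* ≤ b_j`; (2) some `y_iᵀQ` independent of the rows of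
`C` has `|2 y_iᵀQ x*| ≤ n²Δ⁴α`; (3) `‖x* - x₀‖₁ ≤ Δ²n`. -/
theorem stmt_5 (n m p r α Δ : ℕ) (hα : 0 < α) (hΔ : 0 < Δ)
    (Q : Matrix (Fin n) (Fin n) ℤ) (hQ : Q.IsSymm) (hQα : ∀ i j, |Q i j| ≤ (α : ℤ))
    (A : Matrix (Fin m) (Fin n) ℤ) (hAα : ∀ i j, |A i j| ≤ (α : ℤ))
    (b : Fin m → ℤ)
    (C : Matrix (Fin p) (Fin n) ℤ) (d : Fin p → ℤ)
    (hdet : ∀ (k : ℕ) (ρ : Fin k → Fin p) (γ : Fin k → Fin n),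
      |(C.submatrix ρ γ).det| ≤ (Δ : ℤ))
    (y : Fin r → Fin n → ℤ)
    (hy0 : ∀ i, C.mulVec (y i) = 0)
    (hindep : LinearIndependent ℚ (fun i => fun j => ((y i j : ℤ) : ℚ)))
    (hspan : ∀ v : Fin n → ℚ, (C.map ((↑) : ℤ → ℚ)).mulVec v = 0 →
      v ∈ Submodule.span ℚ (Set.range fun i => fun j => ((y i j : ℤ) : ℚ)))
    (hynorm : ∀ i j, |y i j| ≤ (Δ : ℤ) ^ 2)
    (hex : ∃ x : Fin n → ℤ, IsOptimal Q A b C d x)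
    (x0 : Fin n → ℝ) (hx0 : (C.map ((↑) : ℤ → ℝ)).mulVec x0 = fun l => (d l : ℝ)) :
    ∃ xs : Fin n → ℤ, IsOptimal Q A b C d xs ∧
      ((∃ j : Fin m,
          (¬ ∃ lam : Fin p → ℚ, ∀ i, (A j i : ℚ) = ∑ l, lam l * (C l i : ℚ)) ∧
          b j - (α : ℤ) * n * (Δ : ℤ) ^ 2 ≤ A.mulVec xs j ∧ A.mulVec xs j ≤ b j) ∨
        (∃ i : Fin r,
          (¬ ∃ lam : Fin p → ℚ,
            ∀ jj, ((Matrix.vecMul (y i) Q) jj : ℚ) = ∑ l, lam l * (C l jj : ℚ)) ∧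
          |2 * (Matrix.vecMul (y i) Q ⬝ᵥ xs)| ≤ (n : ℤ) ^ 2 * (Δ : ℤ) ^ 4 * (α : ℤ)) ∨
        (∑ j, |(xs j : ℝ) - x0 j| ≤ (Δ : ℝ) ^ 2 * n)) := by
  classical
  by_contra hcon
  have hmove : ∀ xs z : Fin n → ℤ, IsOptimal Q A b C d xs → C *ᵥ z = 0 →
      (∀ i, |z i| ≤ (Δ : ℤ) ^ 2) → IsOptimal Q A b C d (xs - z) := by
    intro xs z hxs hz hzb
    refine aux_closure n m p r α Δ Q hQ hQα A hAα b C d y hy0 hspan hynorm xs hxs ?_ ?_ z hz hzb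
    · exact fun h => hcon ⟨xs, hxs, Or.inl h⟩
    · exact fun h => hcon ⟨xs, hxs, Or.inr (Or.inl h)⟩
  obtain ⟨u, hu, hu1, huF⟩ := aux_vertex (C.map ((↑) : ℤ → ℝ)) x0
  obtain ⟨k, ρ, γ, hγ, hFγ, hdetR, hker⟩ := aux_basis _ _ huF
  set S := C.submatrix ρ γ with hSdef
  have hS : S.det ≠ 0 := by
    intro h
    apply hdetR
    have := RingHom.map_det (Int.castRingHom ℝ) S
    rw [h] at this
    rw [map_zero] at this
    exact this.symm
  have hδ0 : 0 < S.det.natAbs := Int.natAbs_pos.2 hS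
  have hδΔ : S.det.natAbs ≤ Δ := by
    have := hdet k ρ γ
    rw [← hSdef, Int.abs_eq_natAbs] at this
    exact_mod_cast this
  have huint : ∀ j, j ∉ Set.range γ → u j = (⌊u j⌋ : ℝ) := by
    intro j hj
    by_contra h
    apply hj
    apply hFγ
    rintro ⟨z, hz⟩
    apply h
    rw [hz]; simp
  have hΔ1 : (1 : ℝ) ≤ Δ := by exact_mod_cast hΔ
  have hΔZ : (Δ : ℤ) ≤ (Δ : ℤ) ^ 2 := by
    have : (1 : ℤ) ≤ Δ := by exact_mod_cast hΔ
    nlinarith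
  let cc : (Fin n → ℤ) → Fin n → ℤ := fun x j => if j ∈ Set.range γ then 0 else x j - ⌊u j⌋
  let μ : (Fin n → ℤ) → ℕ := fun x => ∑ j, (cc x j).natAbs
  obtain ⟨x, hx, hmin⟩ := (measure μ).wf.has_min {x | IsOptimal Q A b C d x} hex
  have hx : IsOptimal Q A b C d x := hx
  have hmin : ∀ x', IsOptimal Q A b C d x' → μ x ≤ μ x' := fun x' h' => not_lt.1 (hmin x' h')
  have hμ : μ x < S.det.natAbs := by
    by_contra hge
    obtain ⟨t, ht1, ht2, ht3, w, hw⟩ :=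
      aux_conformal S hS (fun j l => C (ρ l) j) (cc x) (not_lt.1 hge)
    let q : Fin n → ℤ := fun j => (cc x j).sign * t j
    let z : Fin n → ℤ := fun j => q j - ∑ a, if γ a = j then w a else 0
    have hzoff : ∀ j, j ∉ Set.range γ → z j = q j := by
      intro j hj
      have : ∀ a, γ a ≠ j := fun a h => hj ⟨a, h⟩
      simp [z, this]
    have hqabs : ∀ j, |q j| ≤ t j := by
      intro j
      simp only [q]
      rw [abs_mul, Nat.abs_cast]
      rcases lt_trichotomy (cc x j) 0 with h | h | h
      · simp [Int.sign_eq_neg_one_of_neg h]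
      · simp [h]
      · simp [Int.sign_eq_one_of_pos h]
    have hzker : ∀ l, (C *ᵥ z) (ρ l) = 0 := by
      intro l
      have hl := congrFun hw l
      simp only [Finset.sum_apply, Pi.smul_apply, smul_eq_mul, Matrix.mulVec, dotProduct,
        hSdef, Matrix.submatrix_apply] at hl
      simp only [Matrix.mulVec, dotProduct, z, mul_sub, Finset.sum_sub_distrib, Finset.mul_sum]
      rw [Finset.sum_comm (f := fun j a => C (ρ l) j * if γ a = j then w a else 0)]
      simp only [mul_ite, mul_zero, Finset.sum_ite_eq, Finset.mem_univ, if_true]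
      rw [← hl, sub_eq_zero]
      apply Finset.sum_congr rfl
      intro j _
      simp only [q]; ring
    have hcast : ∀ l, (C.map ((↑) : ℤ → ℝ) *ᵥ (fun j => (z j : ℝ))) l = ((C *ᵥ z) l : ℤ) := by
      intro l
      simp [Matrix.mulVec, dotProduct]
    have hzkerR : ∀ l, (C.map ((↑) : ℤ → ℝ) *ᵥ (fun j => (z j : ℝ))) (ρ l) = 0 := by
      intro l
      rw [hcast, hzker]; simp
    have hz : C *ᵥ z = 0 := by
      have := hker _ hzkerR
      ext l
      have h2 := congrFun this l
      rw [hcast, Pi.zero_apply] at h2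
      rw [Pi.zero_apply]
      exact_mod_cast h2
    have hzb : ∀ j, |z j| ≤ (Δ : ℤ) := by
      intro j
      by_cases hj : j ∈ Set.range γ
      · obtain ⟨a, rfl⟩ := hj
        have h := aux_cramer C hdet ρ γ hγ (fun j => (z j : ℝ)) hzkerR a
        rw [← hSdef] at h
        have h3 : (∑ j, if j ∈ Set.range γ then (0 : ℝ) else |(z j : ℝ)|) ≤ S.det.natAbs := by
          calc (∑ j, if j ∈ Set.range γ then (0 : ℝ) else |(z j : ℝ)|) ≤ ∑ j, (t j : ℝ) := by
                apply Finset.sum_le_sum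
                intro j _
                split_ifs with hj
                · positivity
                · rw [hzoff j hj]; exact_mod_cast hqabs j
            _ ≤ _ := by exact_mod_cast ht3
        have h4 : |(S.det : ℝ)| = S.det.natAbs := by
          rw [Nat.cast_natAbs]; simp
        rw [h4] at h
        have h5 : (0 : ℝ) < S.det.natAbs := by exact_mod_cast hδ0
        have h6 : |(z (γ a) : ℝ)| ≤ Δ := by
          have := h.trans (mul_le_mul_of_nonneg_left h3 (by positivity))
          rw [mul_comm (Δ : ℝ)] at this
          exact le_of_mul_le_mul_left this h5
        exact_mod_cast h6
      · rw [hzoff j hj]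
        refine (hqabs j).trans ?_
        have : t j ≤ ∑ j, t j := Finset.single_le_sum (fun _ _ => Nat.zero_le _) (Finset.mem_univ j)
        exact_mod_cast this.trans (ht3.trans hδΔ)
    have hopt := hmove x z hx hz (fun i => (hzb i).trans hΔZ)
    have hle := hmin _ hopt
    have hdec : ∀ j, (cc (x - z) j).natAbs + t j = (cc x j).natAbs := by
      intro j
      have hj1 := ht1 j
      by_cases hj : j ∈ Set.range γ
      · have e1 : cc x j = 0 := by simp only [cc, hj, if_true]
        have e2 : cc (x - z) j = 0 := by simp only [cc, hj, if_true]
        rw [e1] at hj1 ⊢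
        rw [e2]
        simpa using hj1
      · have e : cc (x - z) j = cc x j - (cc x j).sign * t j := by
          have := hzoff j hj
          simp only [q] at this
          rw [← this]
          simp only [cc, hj, if_false, Pi.sub_apply]
          ring
        rw [e]
        rcases lt_trichotomy (cc x j) 0 with h | h | h
        · rw [Int.sign_eq_neg_one_of_neg h]; omega
        · rw [h] at hj1 ⊢; simpa using hj1
        · rw [Int.sign_eq_one_of_pos h]; omega
    have hs : μ (x - z) + ∑ j, t j = μ x := by
      simp only [μ, ← Finset.sum_add_distrib]
      exact Finset.sum_congr rfl fun j _ => hdec j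
    omega
  have hxu : ∀ l, (C.map ((↑) : ℤ → ℝ) *ᵥ (fun j => (x j : ℝ) - u j)) (ρ l) = 0 := by
    intro l
    have e1 : (fun j => (x j : ℝ) - u j) = (fun j => (x j : ℝ)) - u := rfl
    have e2 : (C.map ((↑) : ℤ → ℝ) *ᵥ (fun j => (x j : ℝ))) (ρ l) = d (ρ l) := by
      rw [← hx.1.2]
      simp [Matrix.mulVec, dotProduct]
    rw [e1, Matrix.mulVec_sub, Pi.sub_apply, e2, hu, hx0, sub_self]
  have hoff : ∀ j, j ∉ Set.range γ → |(x j : ℝ) - u j| = (cc x j).natAbs := by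
    intro j hj
    rw [Nat.cast_natAbs, huint j hj]
    simp only [cc, hj, if_false]
    push_cast
    rfl
  have hμR : (μ x : ℝ) + 1 ≤ S.det.natAbs := by exact_mod_cast hμ
  have hδR : (S.det.natAbs : ℝ) ≤ Δ := by exact_mod_cast hδΔ
  have hsmall : ∀ j, |(x j : ℝ) - u j| ≤ Δ - 1 := by
    intro j
    by_cases hj : j ∈ Set.range γ
    · obtain ⟨a, rfl⟩ := hj
      have h := aux_cramer C hdet ρ γ hγ (fun j => (x j : ℝ) - u j) hxu a
      rw [← hSdef] at h
      have h3 : (∑ j, if j ∈ Set.range γ then (0 : ℝ) else |(x j : ℝ) - u j|) ≤ μ x := by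
        simp only [μ]
        push_cast
        apply Finset.sum_le_sum
        intro j _
        split_ifs with hj
        · positivity
        · exact (hoff j hj).le.trans (by simp)
      have h4 : |(S.det : ℝ)| = S.det.natAbs := by
        rw [Nat.cast_natAbs]; simp
      rw [h4] at h
      have h5 : (0 : ℝ) < S.det.natAbs := by exact_mod_cast hδ0
      have h6 := h.trans (mul_le_mul_of_nonneg_left h3 (by positivity))
      refine le_of_mul_le_mul_left (h6.trans ?_) h5
      nlinarith
    · rw [hoff j hj]
      have : (cc x j).natAbs ≤ μ x :=
        Finset.single_le_sum (f := fun j => (cc x j).natAbs) (fun _ _ => Nat.zero_le _)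
          (Finset.mem_univ j)
      have : ((cc x j).natAbs : ℝ) ≤ μ x := by exact_mod_cast this
      linarith
  apply hcon
  refine ⟨x, hx, Or.inr (Or.inr ?_)⟩
  refine (Finset.sum_le_card_nsmul _ _ ((Δ : ℝ) ^ 2) fun j _ => ?_).trans
    (by simp [mul_comm])
  have h1 : |(x j : ℝ) - x0 j| ≤ |(x j : ℝ) - u j| + |u j - x0 j| := abs_sub_le _ _ _
  have h2 := hsmall j
  have h3 := hu1 j
  nlinarith
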